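/- Let n be an even positive integer. For every connected graph G = (V, E) without a matching of size n/2 there is a partition V = S ∪ Q ∪ I of the vertex set such that: (1) |Q| + 2|S| = min{v(G), n − 1}; (2) I is an independent set, and if v(G) ≤ n − 1 then I = ∅; (3) every vertex in Q has at most one neighbor in I; (4) every vertex in I has degree less than n/2 in G. -/

import Mathlib

/-- A matching of size `m` in `G`: a set of `m` pairwise disjoint edges of `G`. -/
def HasMatching {V : Type*} (G : SimpleGraph V) (m : ℕ) : Prop :=
  ∃ M : Finset (Sym2 V), M.card = m ∧ (∀ e ∈ M, e ∈ G.edgeSet) ∧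
    (∀ e ∈ M, ∀ f ∈ M, e ≠ f → ∀ v : V, v ∈ e → v ∉ f)

open Finset in
/-- If all vertices of a finite set `A` are covered by a matching of `G` inside `A`, given by an
involution `p`, then `G` has every matching of size at most `#A / 2`. -/
theorem HasMatching.of_involution {V : Type*} [DecidableEq V] {G : SimpleGraph V} {m : ℕ}
    (A : Finset V) (p : V → V) (hadj : ∀ a ∈ A, G.Adj a (p a)) (hinv : ∀ a ∈ A, p (p a) = a)
    (hcard : 2 * m ≤ #A) : HasMatching G m := by
  have hle : #A ≤ 2 * #(A.image fun a ↦ s(a, p a)) := by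
    refine card_le_mul_card_image A 2 fun e _ ↦ ?_
    calc #{a ∈ A | s(a, p a) = e} ≤ #e.toFinset := by
          refine card_le_card fun a ha ↦ ?_
          rw [mem_filter] at ha
          simp [← ha.2, Sym2.mem_toFinset]
      _ ≤ 2 := by rw [Sym2.card_toFinset]; split_ifs <;> omega
  obtain ⟨M, hM, hMcard⟩ := exists_subset_card_eq (show m ≤ #(A.image fun a ↦ s(a, p a)) by omega)
  refine ⟨M, hMcard, fun e he ↦ ?_, fun e he f hf hef v hve hvf ↦ hef ?_⟩
  · obtain ⟨a, ha, rfl⟩ := mem_image.1 (hM he)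
    exact hadj a ha
  · obtain ⟨a, ha, rfl⟩ := mem_image.1 (hM he)
    obtain ⟨b, hb, rfl⟩ := mem_image.1 (hM hf)
    have h₁ : s(a, p a) = s(v, p v) := by
      rcases Sym2.mem_iff.1 hve with rfl | rfl
      · rfl
      · rw [hinv a ha, Sym2.eq_swap]
    have h₂ : s(b, p b) = s(v, p v) := by
      rcases Sym2.mem_iff.1 hvf with rfl | rfl
      · rfl
      · rw [hinv b hb, Sym2.eq_swap]
    rw [h₁, h₂]

namespace SimpleGraph

/-- The join of `G` with the complete graph on `D`. -/
def joinComplete {V : Type*} (G : SimpleGraph V) (D : Type*) : SimpleGraph (V ⊕ D) where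
  Adj x y := x ≠ y ∧ ∀ a b, x = Sum.inl a → y = Sum.inl b → G.Adj a b
  symm := ⟨fun _ _ h ↦ ⟨h.1.symm, fun a b ha hb ↦ (h.2 b a hb ha).symm⟩⟩
  loopless := ⟨fun _ h ↦ h.1 rfl⟩

theorem joinComplete_adj_inl {V D : Type*} {G : SimpleGraph V} {a b : V} :
    (G.joinComplete D).Adj (.inl a) (.inl b) ↔ G.Adj a b := by
  refine ⟨fun h ↦ h.2 a b rfl rfl, fun h ↦ ⟨by simpa using h.ne, ?_⟩⟩
  rintro _ _ ⟨⟩ ⟨⟩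
  exact h

theorem joinComplete_adj_inr {V D : Type*} {G : SimpleGraph V} {x : V ⊕ D} {d : D}
    (h : x ≠ .inr d) : (G.joinComplete D).Adj x (.inr d) :=
  ⟨h, by simp⟩

open Finset in
/-- A perfect matching of the join of `G` with a complete graph on `d` vertices yields
a matching of `G` missing at most `d` vertices. -/
theorem Subgraph.IsPerfectMatching.hasMatching_of_joinComplete {V D : Type*} [Fintype V]
    [Fintype D] {G : SimpleGraph V} {M : (G.joinComplete D).Subgraph} (hM : M.IsPerfectMatching)
    {m : ℕ} (hm : 2 * m + Fintype.card D ≤ Fintype.card V) : HasMatching G m := by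
  classical
  rw [Subgraph.isPerfectMatching_iff] at hM
  choose p hp hpu using hM
  have hpp : ∀ x, p (p x) = x := fun x ↦ (hpu _ _ (hp x).symm).symm
  let q : V → V := fun a ↦ (p (.inl a)).elim id fun _ ↦ a
  let A : Finset V := {a | (p (.inl a)).isLeft}
  have hq : ∀ a ∈ A, p (.inl a) = .inl (q a) := by
    intro a ha
    obtain ⟨b, hb⟩ := Sum.isLeft_iff.1 (mem_filter.1 ha).2
    simp [q, hb]
  refine .of_involution A q (fun a ha ↦ ?_) (fun a ha ↦ ?_) ?_
  · rw [← joinComplete_adj_inl (D := D), ← hq a ha]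
    exact (hp _).adj_sub
  · have h := hpp (.inl a)
    rw [hq a ha] at h
    simp [q, h]
  · have hAc : #Aᶜ ≤ Fintype.card D := by
      have hcard : #(Aᶜ.image fun a ↦ p (.inl a)) ≤ #(univ.image (.inr : D → V ⊕ D)) := by
        refine card_le_card fun x hx ↦ ?_
        obtain ⟨a, ha, rfl⟩ := mem_image.1 hx
        cases h : p (.inl a) with
        | inl b => simp [A, h] at ha
        | inr d => simp
      rw [card_image_of_injective _ Sum.inr_injective, card_image_of_injective, card_univ] at hcard
      · exact hcard
      · intro a b hab
        have := congrArg p hab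
        simpa [hpp] using this
    have := card_add_card_compl A
    omega

open Finset in
/-- Nontrivial half of the Tutte–Berge formula: if `G` has no matching of size `m`, then there is
a set `U` of vertices such that `G - U` has at least `#U + |V| - 2 * m + 2` components; `O` is a
family of that many components. -/
theorem exists_card_components_of_not_hasMatching {V : Type*} [Fintype V]
    (G : SimpleGraph V) {m : ℕ} (hm : 2 * m ≤ Fintype.card V) (hG : ¬ HasMatching G m) :
    ∃ (U : Finset V) (O : Finset (Finset V)), #U + Fintype.card V + 2 ≤ #O + 2 * m ∧
      (∀ F ∈ O, F.Nonempty ∧ Disjoint F U ∧ ∀ v ∈ F, ∀ w ∉ U, G.Adj v w → w ∈ F) ∧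
      (O : Set (Finset V)).PairwiseDisjoint id := by
  classical
  let D := Fin (Fintype.card V - 2 * m)
  obtain ⟨u, hu⟩ : ∃ u, (G.joinComplete D).IsTutteViolator u := by
    by_contra! h
    obtain ⟨M, hM⟩ := tutte.2 h
    exact hG (hM.hasMatching_of_joinComplete (by simp [D]; omega))
  rw [IsTutteViolator] at hu
  set K := ((⊤ : (G.joinComplete D).Subgraph).deleteVerts u).coe with hK
  have hverts : ∀ x, x ∈ ((⊤ : (G.joinComplete D).Subgraph).deleteVerts u).verts ↔ x ∉ u := by
    simp
  have hKadj : ∀ x y, K.Adj x y ↔ (G.joinComplete D).Adj x y := by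
    rintro ⟨x, hx⟩ ⟨y, hy⟩
    simp [hK, (hverts x).1 hx, (hverts y).1 hy]
  have hu2 : u.ncard + 2 ≤ K.oddComponents.ncard := by
    have hodd := K.odd_ncard_oddComponents
    have h₁ : Nat.card ((⊤ : (G.joinComplete D).Subgraph).deleteVerts u).verts + u.ncard =
        Fintype.card V + (Fintype.card V - 2 * m) := by
      have h := Set.ncard_add_ncard_compl u
      rw [Nat.card_sum, Nat.card_eq_fintype_card, Nat.card_eq_fintype_card, Fintype.card_fin] at h
      rw [← h, Nat.card_coe_set_eq, add_comm]
      congr 2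
      ext x
      simp
    rw [Nat.odd_iff, Nat.odd_iff] at hodd
    omega
  have hinr : ∀ d : D, .inr d ∈ u := by
    intro d
    by_contra hd
    have h₁ : ∀ c : K.ConnectedComponent,
        c = K.connectedComponentMk ⟨.inr d, (hverts _).2 hd⟩ := by
      refine ConnectedComponent.ind fun x ↦ ?_
      by_cases hx : x = ⟨.inr d, (hverts _).2 hd⟩
      · rw [hx]
      · refine ConnectedComponent.sound (Adj.reachable ?_)
        rw [hKadj]
        exact joinComplete_adj_inr fun h ↦ hx (Subtype.ext h)
    have h₂ : K.oddComponents.ncard ≤ 1 :=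
      Set.ncard_le_one_iff (Set.toFinite _) |>.2 fun {a b} _ _ ↦ (h₁ a).trans (h₁ b).symm
    omega
  let U : Finset V := {v | .inl v ∈ u}
  have hU : u.ncard = #U + (Fintype.card V - 2 * m) := by
    have h : u = (U.disjSum (univ : Finset D) : Finset (V ⊕ D)) := by
      ext x
      cases x <;> simp [U, hinr]
    rw [h, Set.ncard_coe_finset, card_disjSum, card_univ, Fintype.card_fin]
  let F : K.ConnectedComponent → Finset V :=
    fun c ↦ {v | ∃ h, K.connectedComponentMk ⟨.inl v, h⟩ = c}
  have hmem : ∀ v c, v ∈ F c ↔ ∃ h, K.connectedComponentMk ⟨.inl v, h⟩ = c :=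
    fun v c ↦ by rw [mem_filter, and_iff_right (mem_univ v)]
  have hne : ∀ c, (F c).Nonempty := by
    refine ConnectedComponent.ind ?_
    rintro ⟨v | d, h⟩
    · exact ⟨v, (hmem _ _).2 ⟨h, rfl⟩⟩
    · exact absurd (hinr d) ((hverts _).1 h)
  have hdisj : ∀ v c c', v ∈ F c → v ∈ F c' → c = c' := by
    intro v c c' h h'
    obtain ⟨_, rfl⟩ := (hmem _ _).1 h
    obtain ⟨_, rfl⟩ := (hmem _ _).1 h'
    rfl
  have hinj : F.Injective := fun c c' h ↦ by
    obtain ⟨v, hv⟩ := hne c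
    exact hdisj v c c' hv (h ▸ hv)
  refine ⟨U, K.oddComponents.toFinite.toFinset.image F, ?_, ?_, ?_⟩
  · rw [card_image_of_injective _ hinj, ← Set.ncard_eq_toFinset_card]
    omega
  · intro A hA
    obtain ⟨c, -, rfl⟩ := mem_image.1 hA
    refine ⟨hne c, Finset.disjoint_left.2 fun v hv hvU ↦ ?_, fun v hv w hw hvw ↦ ?_⟩
    · obtain ⟨h, -⟩ := (hmem _ _).1 hv
      exact (hverts _).1 h (mem_filter.1 hvU).2
    · obtain ⟨h, rfl⟩ := (hmem _ _).1 hv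
      refine (hmem _ _).2 ⟨(hverts _).2 (by simpa [U] using hw), ?_⟩
      refine ConnectedComponent.sound (Adj.reachable ?_)
      rw [hKadj]
      exact joinComplete_adj_inl.2 hvw.symm
  · intro A hA B hB hAB
    obtain ⟨c, -, rfl⟩ := mem_image.1 hA
    obtain ⟨c', -, rfl⟩ := mem_image.1 hB
    refine Finset.disjoint_left.2 fun v hv hv' ↦ hAB ?_
    rw [hdisj v c c' hv hv']

end SimpleGraph

theorem stmt6 (n : ℕ) (hn : Even n) (hn0 : 0 < n)
    (V : Type*) [Fintype V] (G : SimpleGraph V) (hconn : G.Connected)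
    (hnm : ¬ HasMatching G (n / 2)) :
    ∃ S Q I : Set V,
      S ∪ Q ∪ I = Set.univ ∧ Disjoint S Q ∧ Disjoint S I ∧ Disjoint Q I ∧
      Q.ncard + 2 * S.ncard = min (Fintype.card V) (n - 1) ∧
      (∀ u ∈ I, ∀ v ∈ I, ¬ G.Adj u v) ∧
      (Fintype.card V ≤ n - 1 → I = ∅) ∧
      (∀ q ∈ Q, ∀ v₁ ∈ I, ∀ v₂ ∈ I, G.Adj q v₁ → G.Adj q v₂ → v₁ = v₂) ∧
      (∀ v ∈ I, (G.neighborSet v).ncard < n / 2) := by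
  classical
  open Finset in
  by_cases hle : Fintype.card V ≤ n - 1
  · exact ⟨∅, Set.univ, ∅, by simp, by simp, by simp, by simp, by simp [hle], by simp, by simp,
      by simp, by simp⟩
  obtain ⟨U, O, hcard, hO, hdisj⟩ :=
    G.exists_card_components_of_not_hasMatching (m := n / 2) (by omega) hnm
  have hn2 : 2 * (n / 2) = n := Nat.two_mul_div_two_of_even hn
  have hone : ∀ A ∈ O, 1 ≤ #A := fun A hA ↦ (hO A hA).1.card_pos
  have hsum : ∑ A ∈ O, #A + #U ≤ Fintype.card V := by
    change ∑ A ∈ O, #(id A) + #U ≤ _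
    rw [← card_biUnion hdisj, ← card_union_of_disjoint]
    · exact card_le_univ _
    · exact (disjoint_biUnion_left _ _ _).2 fun A hA ↦ (hO A hA).2.1
  -- At most one component is large enough to contain a vertex of degree at least `n / 2`.
  have hbad : #{A ∈ O | n / 2 < #U + #A} ≤ 1 := by
    refine card_le_one.2 fun A hA B hB ↦ ?_
    by_contra hAB
    rw [mem_filter] at hA hB
    have hBA : B ∈ O.erase A := mem_erase.2 ⟨Ne.symm hAB, hB.1⟩
    have h₁ := add_sum_erase O card hA.1
    have h₂ := add_sum_erase (O.erase A) card hBA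
    have h₃ := card_nsmul_le_sum ((O.erase A).erase B) (fun C ↦ #C) 1
      fun C hC ↦ hone C (mem_of_mem_erase (mem_of_mem_erase hC))
    rw [card_erase_of_mem hBA, card_erase_of_mem hA.1, smul_eq_mul, mul_one] at h₃
    omega
  obtain ⟨P, hP, hPcard⟩ : ∃ P ⊆ {A ∈ O | ¬ n / 2 < #U + #A},
      #P = Fintype.card V + #U + 1 - n := by
    refine exists_subset_card_eq ?_
    have := card_filter_add_card_filter_not (s := O) fun A ↦ n / 2 < #U + #A
    omega
  have hPO : ∀ A ∈ P, A ∈ O := fun A hA ↦ (mem_filter.1 (hP hA)).1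
  have : Nonempty V := hconn.nonempty
  choose! w hw using fun A hA ↦ (hO A hA).1
  have hunique : ∀ A ∈ O, ∀ B ∈ O, ∀ v, v ∈ A → v ∈ B → A = B := by
    intro A hA B hB v hvA hvB
    by_contra hAB
    exact disjoint_left.1 (hdisj hA hB hAB) hvA hvB
  have hwU : ∀ A ∈ O, w A ∉ U := fun A hA ↦ disjoint_left.1 (hO A hA).2.1 (hw A hA)
  have hIcard : #(P.image w) = #P := card_image_of_injOn fun A hA B hB h ↦
    hunique A (hPO A hA) B (hPO B hB) (w A) (hw A (hPO A hA)) (h ▸ hw B (hPO B hB))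
  have hUI : Disjoint U (P.image w) := by
    refine disjoint_right.2 fun v hv ↦ ?_
    obtain ⟨A, hA, rfl⟩ := mem_image.1 hv
    exact hwU A (hPO A hA)
  have hIV : #(U ∪ P.image w) + #(U ∪ P.image w)ᶜ = Fintype.card V := card_add_card_compl _
  rw [card_union_of_disjoint hUI] at hIV
  refine ⟨U, ((U ∪ P.image w)ᶜ : Finset V), (P.image w : Finset V), ?_, ?_, ?_, ?_, ?_, ?_, ?_,
    ?_, ?_⟩
  · ext v
    by_cases h₁ : v ∈ U <;> by_cases h₂ : v ∈ P.image w <;>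
      simp only [Set.mem_union, mem_coe, mem_compl, mem_union, Set.mem_univ, h₁, h₂] <;> simp
  · exact disjoint_coe.2 (disjoint_compl_right.mono_left subset_union_left)
  · exact disjoint_coe.2 hUI
  · exact disjoint_coe.2 (disjoint_compl_left.mono_right subset_union_right)
  · rw [Set.ncard_coe_finset, Set.ncard_coe_finset]
    omega
  · intro u hu v hv huv
    obtain ⟨A, hA, rfl⟩ := mem_image.1 (mem_coe.1 hu)
    obtain ⟨B, hB, rfl⟩ := mem_image.1 (mem_coe.1 hv)
    have hA' := hPO A hA
    have hB' := hPO B hB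
    have h := hunique A hA' B hB' (w B) ((hO A hA').2.2 _ (hw A hA') _ (hwU B hB') huv) (hw B hB')
    exact huv.ne (congrArg w h)
  · exact fun h ↦ absurd h hle
  · intro q hq v₁ hv₁ v₂ hv₂ h₁ h₂
    obtain ⟨A, hA, rfl⟩ := mem_image.1 (mem_coe.1 hv₁)
    obtain ⟨B, hB, rfl⟩ := mem_image.1 (mem_coe.1 hv₂)
    have hA' := hPO A hA
    have hB' := hPO B hB
    have hqU : q ∉ U := fun h ↦ mem_compl.1 (mem_coe.1 hq) (mem_union_left _ h)
    rw [hunique A hA' B hB' q ((hO A hA').2.2 _ (hw A hA') _ hqU h₁.symm)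
      ((hO B hB').2.2 _ (hw B hB') _ hqU h₂.symm)]
  · intro v hv
    obtain ⟨A, hA, rfl⟩ := mem_image.1 (mem_coe.1 hv)
    have hA' := hPO A hA
    have hsub : G.neighborSet (w A) ⊆ (U ∪ A.erase (w A) : Finset V) := by
      intro x hx
      rw [mem_coe, mem_union, mem_erase]
      by_cases hxU : x ∈ U
      · exact .inl hxU
      · exact .inr ⟨hx.ne', (hO A hA').2.2 _ (hw A hA') _ hxU hx⟩
    have h₁ := Set.ncard_le_ncard hsub (finite_toSet _)
    rw [Set.ncard_coe_finset] at h₁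
    have h₂ := card_union_le U (A.erase (w A))
    rw [card_erase_of_mem (hw A hA')] at h₂
    have h₃ := (mem_filter.1 (hP hA)).2
    have h₄ := hone A hA'
    omega
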